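/- Suppose the algebra C(a,b,c,d;ε,δ) is curled. Then C(a,b,c,d;ε,δ) is associative if and only if (a,b,c,d,ε,δ) is one of (0,0,0,0,0,0), (0,1,0,0,1,0), (0,0,0,1,1,0), (0,0,1,0,0,1), (1,0,0,0,0,1), (0,0,0,0,1,1), (0,1,0,1,1,1), (1,0,1,0,1,1), (0,1,1,0,1,1), (1,0,0,1,1,1). -/

import Mathlib

/-- The field with two elements. -/
abbrev F2 : Type := ZMod 2

/-- The two-dimensional `F2`-vector space. -/
abbrev V : Type := F2 × F2

/-- A two-dimensional algebra over `F2`: an `F2`-bilinear multiplication on `V`. -/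
abbrev Mul2 : Type := V →ₗ[F2] V →ₗ[F2] V

/-- The two-dimensional algebra over `F2` whose structure matrix (w.r.t. the standard
basis `e = (1,0)`, `f = (0,1)`) is `M`; the rows of `M` give `e²`, `f²`, `e·f`, `f·e`. -/
def mulOf (M : Matrix (Fin 4) (Fin 2) F2) : Mul2 :=
  LinearMap.mk₂ F2
    (fun x y =>
      (x.1 * y.1 * M 0 0 + x.2 * y.2 * M 1 0 + x.1 * y.2 * M 2 0 + x.2 * y.1 * M 3 0,
       x.1 * y.1 * M 0 1 + x.2 * y.2 * M 1 1 + x.1 * y.2 * M 2 1 + x.2 * y.1 * M 3 1))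
    (by intro m n p; simp [Prod.ext_iff]; constructor <;> ring)
    (by intro c m p; simp [Prod.ext_iff, smul_eq_mul]; constructor <;> ring)
    (by intro m n p; simp [Prod.ext_iff]; constructor <;> ring)
    (by intro c m p; simp [Prod.ext_iff, smul_eq_mul]; constructor <;> ring)

/-- The first standard basis vector. -/
def e : V := (1, 0)

/-- The second standard basis vector. -/
def f : V := (0, 1)

/-- The structure matrix of a two-dimensional algebra over `F2` w.r.t. the standard basis:
its rows are the coordinates of `e²`, `f²`, `e·f`, `f·e`. -/
def structMatrix (μ : Mul2) : Matrix (Fin 4) (Fin 2) F2 :=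
  ![![(μ e e).1, (μ e e).2],
    ![(μ f f).1, (μ f f).2],
    ![(μ e f).1, (μ e f).2],
    ![(μ f e).1, (μ f e).2]]

/-- Two two-dimensional algebras over `F2` are isomorphic: there is an `F2`-linear
bijection preserving multiplication. -/
def IsIso (μ μ' : Mul2) : Prop :=
  ∃ φ : V ≃ₗ[F2] V, ∀ x y : V, φ (μ x y) = μ' (φ x) (φ y)

/-- An algebra is endo-commutative if `(x·x)·(y·y) = (x·y)·(x·y)` for all `x, y`. -/
def EndoCommutative (μ : Mul2) : Prop :=
  ∀ x y : V, μ (μ x x) (μ y y) = μ (μ x y) (μ x y)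

/-- An algebra is curled if every square `x·x` is a scalar multiple of `x`. -/
def Curled (μ : Mul2) : Prop := ∀ x : V, ∃ lam : F2, μ x x = lam • x

/-- An algebra is commutative if `x·y = y·x` for all `x, y`. -/
def IsCommutative2 (μ : Mul2) : Prop := ∀ x y : V, μ x y = μ y x

/-- An algebra is associative if `(x·y)·z = x·(y·z)` for all `x, y, z`. -/
def IsAssociative2 (μ : Mul2) : Prop := ∀ x y z : V, μ (μ x y) z = μ x (μ y z)

/-- An algebra is unital if it has a two-sided unit. -/
def IsUnital2 (μ : Mul2) : Prop := ∃ u : V, ∀ x : V, μ u x = x ∧ μ x u = x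

/-- An algebra is zeropotent if `x·x = 0` for all `x`. -/
def Zeropotent (μ : Mul2) : Prop := ∀ x : V, μ x x = 0

/-- For `X = [[a,b],[c,d]]`, `tilde X` is the 4×4 matrix with rows
`(a,b,ab,ab)`, `(c,d,cd,cd)`, `(ac,bd,ad,bc)`, `(ac,bd,bc,ad)`. -/
def tilde (X : Matrix (Fin 2) (Fin 2) F2) : Matrix (Fin 4) (Fin 4) F2 :=
  ![![X 0 0, X 0 1, X 0 0 * X 0 1, X 0 0 * X 0 1],
    ![X 1 0, X 1 1, X 1 0 * X 1 1, X 1 0 * X 1 1],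
    ![X 0 0 * X 1 0, X 0 1 * X 1 1, X 0 0 * X 1 1, X 0 1 * X 1 0],
    ![X 0 0 * X 1 0, X 0 1 * X 1 1, X 0 1 * X 1 0, X 0 0 * X 1 1]]

/-- The curled-type algebra `C(a,b,c,d;ε,δ)`:
`e² = ε·e`, `f² = δ·f`, `e·f = a·e + b·f`, `f·e = c·e + d·f`. -/
def Calg (a b c d ε δ : F2) : Mul2 := mulOf ![![ε, 0], ![0, δ], ![a, b], ![c, d]]

/-- The straight-type algebra `S(p,q,a,b,c,d)`:
`e² = f`, `f² = p·e + q·f`, `e·f = a·e + b·f`, `f·e = c·e + d·f`. -/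
def Salg (p q a b c d : F2) : Mul2 := mulOf ![![0, 1], ![p, q], ![a, b], ![c, d]]

theorem Calg_apply (a b c d ε δ : F2) (x y : V) :
    Calg a b c d ε δ x y =
      (x.1 * y.1 * ε + x.1 * y.2 * a + x.2 * y.1 * c,
       x.2 * y.2 * δ + x.1 * y.2 * b + x.2 * y.1 * d) := by
  simp [Calg, mulOf]

/-- The square of `e + f` is a multiple of `e + f` in a curled `C(a,b,c,d;ε,δ)`. -/
theorem Curled.Calg_add_eq {a b c d ε δ : F2} (h : Curled (Calg a b c d ε δ)) :
    ε + a + c = δ + b + d := by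
  obtain ⟨r, hr⟩ := h (1, 1)
  simp only [Calg_apply, Prod.ext_iff, Prod.smul_fst, Prod.smul_snd, one_mul] at hr
  exact hr.1.trans hr.2.symm

/-- Associativity of `C(a,b,c,d;ε,δ)` in terms of its structure constants. -/
theorem isAssociative2_Calg_iff (a b c d ε δ : F2) :
    IsAssociative2 (Calg a b c d ε δ) ↔
      a * b = 0 ∧ c * d = 0 ∧ ε * b = b * b ∧ ε * d = d * d ∧ δ * a = a * a ∧ δ * c = c * c ∧
        a * ε + b * c = c * ε + a * d ∧ b * c + d * δ = a * d + b * δ := by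
  simp only [IsAssociative2, Calg_apply, Prod.ext_iff]
  constructor
  · intro h
    have heef := h e e f
    have hefe := h e f e
    have hfee := h f e e
    have hffe := h f f e
    have hfef := h f e f
    have heff := h e f f
    simp only [e, f] at heef hefe hfee hffe hfef heff
    grind
  · rintro ⟨hab, hcd, hb, hd, ha, hc, hε, hδ⟩ ⟨x₁, x₂⟩ ⟨y₁, y₂⟩ ⟨z₁, z₂⟩
    constructor <;> dsimp only
    · linear_combination x₁ * y₂ * z₁ * hε - x₁ * y₁ * z₂ * hab + x₂ * y₁ * z₁ * hcd +
        x₂ * y₂ * z₁ * hc - x₁ * y₂ * z₂ * ha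
    · linear_combination x₂ * y₁ * z₂ * hδ + x₁ * y₁ * z₂ * hb - x₂ * y₁ * z₁ * hd +
        x₁ * y₂ * z₂ * hab - x₂ * y₂ * z₁ * hcd

/-- A curled `C(a,b,c,d;ε,δ)` is associative iff `(a,b,c,d,ε,δ)` is one of the
ten listed tuples. -/
theorem Calg_associative_iff (a b c d ε δ : F2) (h : Curled (Calg a b c d ε δ)) :
    IsAssociative2 (Calg a b c d ε δ) ↔
      (((a, b, c, d, ε, δ) : F2 × F2 × F2 × F2 × F2 × F2) = (0, 0, 0, 0, 0, 0) ∨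
       ((a, b, c, d, ε, δ) : F2 × F2 × F2 × F2 × F2 × F2) = (0, 1, 0, 0, 1, 0) ∨
       ((a, b, c, d, ε, δ) : F2 × F2 × F2 × F2 × F2 × F2) = (0, 0, 0, 1, 1, 0) ∨
       ((a, b, c, d, ε, δ) : F2 × F2 × F2 × F2 × F2 × F2) = (0, 0, 1, 0, 0, 1) ∨
       ((a, b, c, d, ε, δ) : F2 × F2 × F2 × F2 × F2 × F2) = (1, 0, 0, 0, 0, 1) ∨
       ((a, b, c, d, ε, δ) : F2 × F2 × F2 × F2 × F2 × F2) = (0, 0, 0, 0, 1, 1) ∨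
       ((a, b, c, d, ε, δ) : F2 × F2 × F2 × F2 × F2 × F2) = (0, 1, 0, 1, 1, 1) ∨
       ((a, b, c, d, ε, δ) : F2 × F2 × F2 × F2 × F2 × F2) = (1, 0, 1, 0, 1, 1) ∨
       ((a, b, c, d, ε, δ) : F2 × F2 × F2 × F2 × F2 × F2) = (0, 1, 1, 0, 1, 1) ∨
       ((a, b, c, d, ε, δ) : F2 × F2 × F2 × F2 × F2 × F2) = (1, 0, 0, 1, 1, 1)) := by
  replace h := h.Calg_add_eq
  rw [isAssociative2_Calg_iff]
  revert a b c d ε δ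
  set_option synthInstance.maxSize 2000 in
  decide
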